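/- Let Λ ⊆ V be finite and nonempty with connected induced subgraph, let Γ be a nonempty proper subset of Λ, and let q : Λ → ℝ. Then λ_Γ(q|_Γ; G) < λ_Λ(q; G), i.e. the principal Dirichlet eigenvalue is strictly monotone under strict inclusion into a finite connected set. -/

import Mathlib

open scoped ENNReal BigOperators

/-- degree of a vertex (cardinality of the neighbour set) -/
noncomputable def degR {V : Type*} (G : SimpleGraph V) (x : V) : ℝ :=
  ((G.neighborSet x).ncard : ℝ)

/-- normalised Laplacian -/
noncomputable def lapl {V : Type*} (G : SimpleGraph V) (f : V → ℝ) (x : V) : ℝ :=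
  (1 / degR G x) * ∑ᶠ y ∈ G.neighborSet x, (f y - f x)

/-- degree-weighted inner product -/
noncomputable def dInner {V : Type*} (G : SimpleGraph V) (φ ψ : V → ℝ) : ℝ :=
  ∑ᶠ x, degR G x * φ x * ψ x

/-- principal Dirichlet eigenvalue of `Δ + q` on the finite set `Λ`,
via the Rayleigh–Ritz formula -/
noncomputable def pev {V : Type*} (G : SimpleGraph V) (Λ : Finset V) (q : V → ℝ) : ℝ :=
  sSup { r | ∃ φ : V → ℝ, (∀ x ∉ Λ, φ x = 0) ∧ dInner G φ φ = 1 ∧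
    r = ∑ x ∈ Λ, degR G x * (lapl G φ x + q x * φ x) * φ x }

/-- The quadratic form of `Δ + q` on `Λ`, in terms of adjacency inside `Λ`. -/
noncomputable def dirichletForm {V : Type*} (G : SimpleGraph V) (Λ : Finset V) (q φ : V → ℝ) : ℝ :=
  open Classical in
  ∑ x ∈ Λ, ∑ y ∈ Λ, (if G.Adj x y then φ x * φ y else 0) +
    ∑ x ∈ Λ, degR G x * (q x - 1) * φ x ^ 2

/-- The functions supported in `Λ` of unit degree-weighted norm. -/
def dirichletSphere {V : Type*} (G : SimpleGraph V) (Λ : Finset V) : Set (V → ℝ) :=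
  {φ | (∀ x ∉ Λ, φ x = 0) ∧ ∑ x ∈ Λ, degR G x * φ x ^ 2 = 1}

lemma one_le_degR {V : Type*} (G : SimpleGraph V) {x : V} (hf : (G.neighborSet x).Finite)
    (hn : (G.neighborSet x).Nonempty) : 1 ≤ degR G x := by
  unfold degR
  exact_mod_cast (Set.ncard_pos hf).2 hn

lemma dInner_self_eq_sum {V : Type*} (G : SimpleGraph V) {Λ : Finset V} {φ : V → ℝ}
    (hφ : ∀ x ∉ Λ, φ x = 0) : dInner G φ φ = ∑ x ∈ Λ, degR G x * φ x ^ 2 := by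
  unfold dInner
  rw [finsum_eq_sum_of_support_subset (s := Λ)]
  · exact Finset.sum_congr rfl fun x _ => by ring
  · intro x hx
    by_contra h
    exact hx (by simp [hφ x h])

lemma rayleigh_eq_dirichletForm {V : Type*} (G : SimpleGraph V)
    (hlf : ∀ x, (G.neighborSet x).Finite) (hdeg : ∀ x, (G.neighborSet x).Nonempty)
    {Λ : Finset V} (q : V → ℝ) {φ : V → ℝ} (hφ : ∀ x ∉ Λ, φ x = 0) :
    ∑ x ∈ Λ, degR G x * (lapl G φ x + q x * φ x) * φ x = dirichletForm G Λ q φ := by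
  classical
  unfold dirichletForm
  rw [← Finset.sum_add_distrib]
  refine Finset.sum_congr rfl fun x _ => ?_
  have hd : degR G x ≠ 0 := by linarith [one_le_degR G (hlf x) (hdeg x)]
  have hsum : ∑ y ∈ (hlf x).toFinset, φ y = ∑ y ∈ Λ, if G.Adj x y then φ y else 0 := by
    rw [← Finset.sum_filter]
    symm
    refine Finset.sum_subset (fun y hy => ?_) fun y hy hy' => hφ y fun h => hy' ?_
    · simpa using (Finset.mem_filter.1 hy).2
    · exact Finset.mem_filter.2 ⟨h, by simpa using hy⟩
  have hlap : degR G x * lapl G φ x =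
      (∑ y ∈ Λ, if G.Adj x y then φ y else 0) - degR G x * φ x := by
    unfold lapl
    rw [finsum_mem_eq_finite_toFinset_sum _ (hlf x), Finset.sum_sub_distrib, hsum,
      Finset.sum_const, nsmul_eq_mul, ← Set.ncard_eq_toFinset_card _ (hlf x)]
    change degR G x * (1 / degR G x * (_ - degR G x * φ x)) = _
    field_simp
  have hmul : ∑ y ∈ Λ, (if G.Adj x y then φ x * φ y else 0) =
      (∑ y ∈ Λ, if G.Adj x y then φ y else 0) * φ x := by
    rw [Finset.sum_mul]
    exact Finset.sum_congr rfl fun y _ => by split_ifs <;> ring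
  rw [hmul, mul_add, hlap]
  ring

lemma pev_eq_sSup_image {V : Type*} (G : SimpleGraph V)
    (hlf : ∀ x, (G.neighborSet x).Finite) (hdeg : ∀ x, (G.neighborSet x).Nonempty)
    (Λ : Finset V) (q : V → ℝ) :
    pev G Λ q = sSup (dirichletForm G Λ q '' dirichletSphere G Λ) := by
  unfold pev
  congr 1
  ext r
  constructor
  · rintro ⟨φ, h0, h1, rfl⟩
    exact ⟨φ, ⟨h0, by rw [← dInner_self_eq_sum G h0, h1]⟩,
      (rayleigh_eq_dirichletForm G hlf hdeg q h0).symm⟩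
  · rintro ⟨φ, ⟨h0, h1⟩, rfl⟩
    exact ⟨φ, h0, by rw [dInner_self_eq_sum G h0, h1],
      (rayleigh_eq_dirichletForm G hlf hdeg q h0).symm⟩

lemma continuous_dirichletForm {V : Type*} (G : SimpleGraph V) (Λ : Finset V) (q : V → ℝ) :
    Continuous (dirichletForm G Λ q) := by
  classical
  unfold dirichletForm
  refine Continuous.add (continuous_finsetSum _ fun x _ => continuous_finsetSum _ fun y _ => ?_)
    (by fun_prop)
  split_ifs <;> fun_prop

lemma isCompact_dirichletSphere {V : Type*} (G : SimpleGraph V)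
    (hlf : ∀ x, (G.neighborSet x).Finite) (hdeg : ∀ x, (G.neighborSet x).Nonempty)
    (Λ : Finset V) : IsCompact (dirichletSphere G Λ) := by
  refine (isCompact_univ_pi fun _ : V => isCompact_Icc (a := (-1 : ℝ)) (b := 1)).of_isClosed_subset
    ?_ ?_
  · have h : dirichletSphere G Λ =
        (⋂ x, ⋂ (_ : x ∉ Λ), {φ | φ x = 0}) ∩ {φ | ∑ x ∈ Λ, degR G x * φ x ^ 2 = 1} := by
      ext φ; simp [dirichletSphere]
    rw [h]
    exact (isClosed_iInter fun x => isClosed_iInter fun _ =>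
      isClosed_eq (continuous_apply x) continuous_const).inter
        (isClosed_eq (by fun_prop) continuous_const)
  · rintro φ ⟨h0, h1⟩ x -
    rw [Set.mem_Icc, ← abs_le, ← sq_le_one_iff_abs_le_one]
    by_cases hx : x ∈ Λ
    · have hle := Finset.single_le_sum (f := fun x => degR G x * φ x ^ 2)
        (fun y _ => mul_nonneg (zero_le_one.trans (one_le_degR G (hlf y) (hdeg y)))
          (sq_nonneg _)) hx
      have h1x := one_le_degR G (hlf x) (hdeg x)
      nlinarith [sq_nonneg (φ x)]
    · simp [h0 x hx]

lemma dirichletSphere_nonempty {V : Type*} (G : SimpleGraph V)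
    (hlf : ∀ x, (G.neighborSet x).Finite) (hdeg : ∀ x, (G.neighborSet x).Nonempty)
    {Λ : Finset V} (hΛ : Λ.Nonempty) : (dirichletSphere G Λ).Nonempty := by
  classical
  obtain ⟨a, ha⟩ := hΛ
  have hd := one_le_degR G (hlf a) (hdeg a)
  refine ⟨fun x => if x = a then (√(degR G a))⁻¹ else 0, fun x hx => ?_, ?_⟩
  · exact if_neg fun h : x = a => hx (h ▸ ha)
  · simp only [ite_pow, ne_eq, OfNat.ofNat_ne_zero, not_false_eq_true, zero_pow, mul_ite, mul_zero,
      Finset.sum_ite_eq', ha, if_true, inv_pow]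
    rw [Real.sq_sqrt (by linarith)]
    exact mul_inv_cancel₀ (by linarith)

lemma dirichletForm_le_abs {V : Type*} (G : SimpleGraph V) (Λ : Finset V) (q φ : V → ℝ) :
    dirichletForm G Λ q φ ≤ dirichletForm G Λ q (fun x => |φ x|) := by
  classical
  unfold dirichletForm
  simp only [sq_abs]
  gcongr with x _ y _
  split_ifs
  · rw [← abs_mul]; exact le_abs_self _
  · exact le_rfl

lemma dirichletForm_mono_support {V : Type*} (G : SimpleGraph V) {Γ Λ : Finset V} (h : Γ ⊆ Λ)
    (q : V → ℝ) {φ : V → ℝ} (hφ : ∀ x ∉ Γ, φ x = 0) :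
    dirichletForm G Γ q φ = dirichletForm G Λ q φ := by
  classical
  unfold dirichletForm
  congr 1
  · rw [← Finset.sum_subset h fun x _ hx => by simp [hφ x hx]]
    exact Finset.sum_congr rfl fun x _ =>
      Finset.sum_subset h fun y _ hy => by simp [hφ y hy]
  · exact Finset.sum_subset h fun x _ hx => by simp [hφ x hx]

lemma dirichletForm_smul {V : Type*} (G : SimpleGraph V) (Λ : Finset V) (q φ : V → ℝ) (c : ℝ) :
    dirichletForm G Λ q (c • φ) = c ^ 2 * dirichletForm G Λ q φ := by
  classical
  unfold dirichletForm
  simp only [mul_add, Finset.mul_sum, Pi.smul_apply, smul_eq_mul, mul_ite, mul_zero]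
  congr 1
  · exact Finset.sum_congr rfl fun x _ => Finset.sum_congr rfl fun y _ => by
      split_ifs <;> ring
  · exact Finset.sum_congr rfl fun x _ => by ring

open Classical in
lemma dirichletForm_add_single {V : Type*} (G : SimpleGraph V) {Λ : Finset V} (q : V → ℝ)
    {φ : V → ℝ} {a : V} (ha : a ∈ Λ) (hφa : φ a = 0) (t : ℝ) :
    dirichletForm G Λ q (φ + Pi.single a t) = dirichletForm G Λ q φ +
      2 * t * ∑ y ∈ Λ, (if G.Adj a y then φ y else 0) + t ^ 2 * (degR G a * (q a - 1)) := by
  have hsq : ∀ x, degR G x * (q x - 1) * (φ x + (Pi.single a t : V → ℝ) x) ^ 2 =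
      degR G x * (q x - 1) * φ x ^ 2 +
        if x = a then t ^ 2 * (degR G x * (q x - 1)) else 0 := by
    intro x
    by_cases hx : x = a
    · subst hx; simp [hφa]; ring
    · simp [hx]
  have hcross : ∀ x y, (if G.Adj x y then
      (φ x + (Pi.single a t : V → ℝ) x) * (φ y + (Pi.single a t : V → ℝ) y) else 0) =
      (if G.Adj x y then φ x * φ y else 0) +
        (if x = a then t * (if G.Adj a y then φ y else 0) else 0) +
        (if y = a then t * (if G.Adj a x then φ x else 0) else 0) := by
    intro x y
    by_cases hx : x = a <;> by_cases hy : y = a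
    · subst hx; subst hy; simp
    · subst hx; simp [hy, hφa]
    · subst hy; simp [hx, hφa, G.adj_comm, mul_comm]
    · simp [hx, hy]
  unfold dirichletForm
  simp only [Pi.add_apply, hsq, hcross, Finset.sum_add_distrib, Finset.sum_ite_eq', ha, if_true]
  rw [Finset.sum_comm (f := fun x y => if x = a then t * (if G.Adj a y then φ y else 0) else 0)]
  simp only [Finset.sum_ite_eq', ha, if_true, ← Finset.mul_sum]
  ring

lemma exists_adj_of_induce_connected {V : Type*} (G : SimpleGraph V) {Λ : Set V}
    (hconn : (G.induce Λ).Connected) (p : V → Prop) {u v : V} (hu : u ∈ Λ) (hv : v ∈ Λ)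
    (hpu : p u) (hpv : ¬ p v) : ∃ x ∈ Λ, ∃ y ∈ Λ, G.Adj x y ∧ p x ∧ ¬ p y := by
  obtain ⟨w⟩ := hconn.preconnected ⟨u, hu⟩ ⟨v, hv⟩
  obtain ⟨d, -, h1, h2⟩ := w.exists_boundary_dart {x | p x} hpu hpv
  exact ⟨d.fst, d.fst.2, d.snd, d.snd.2, d.adj, h1, h2⟩

lemma exists_pos_quadratic {b : ℝ} (hb : 0 < b) (c : ℝ) : ∃ t : ℝ, 0 < 2 * t * b + t ^ 2 * c := by
  refine ⟨b / (|c| + 1), ?_⟩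
  have hc : 0 < |c| + 1 := by positivity
  have h : 2 * (b / (|c| + 1)) * b + (b / (|c| + 1)) ^ 2 * c =
      (b / (|c| + 1)) ^ 2 * (2 * (|c| + 1) + c) := by
    field_simp
  rw [h]
  have := neg_abs_le c
  have := abs_nonneg c
  exact mul_pos (by positivity) (by linarith)

/-- strict monotonicity of the principal Dirichlet eigenvalue under
strict inclusion into a finite connected set. -/
theorem pev_strict_mono {V : Type*} (G : SimpleGraph V)
    (hlf : ∀ x, (G.neighborSet x).Finite)
    (hdeg : ∀ x, (G.neighborSet x).Nonempty)
    (Γ Λ : Finset V) (hΓ : Γ.Nonempty) (hΓΛ : Γ ⊂ Λ)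
    (hconn : (G.induce (↑Λ : Set V)).Connected)
    (q : V → ℝ) :
    pev G Γ q < pev G Λ q := by
  classical
  rw [pev_eq_sSup_image G hlf hdeg, pev_eq_sSup_image G hlf hdeg]
  obtain ⟨φ, ⟨hφ0, hφ1⟩, hφmax⟩ := (isCompact_dirichletSphere G hlf hdeg Γ).exists_sSup_image_eq
    (dirichletSphere_nonempty G hlf hdeg hΓ) (continuous_dirichletForm G Γ q).continuousOn
  rw [hφmax]
  set l := dirichletForm G Γ q φ
  set f : V → ℝ := fun x => |φ x| with hf
  have hf0 : ∀ x ∉ Γ, f x = 0 := fun x hx => by simp [hf, hφ0 x hx]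
  have hfl : l ≤ dirichletForm G Λ q f :=
    (dirichletForm_le_abs G Γ q φ).trans (dirichletForm_mono_support G hΓΛ.1 q hf0).le
  have hf1 : ∑ x ∈ Λ, degR G x * f x ^ 2 = 1 := by
    rw [← Finset.sum_subset hΓΛ.1 fun x _ hx => by simp [hf0 x hx]]
    simpa [hf] using hφ1
  obtain ⟨v, hvΛ, hvΓ⟩ := Finset.exists_of_ssubset hΓΛ
  obtain ⟨u, huΛ, hu⟩ : ∃ u ∈ Λ, f u ≠ 0 := by
    by_contra! h
    rw [Finset.sum_eq_zero fun x hx => by simp [h x hx]] at hf1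
    exact zero_ne_one hf1
  obtain ⟨b, hb, a, ha, hab, hfb, hfa⟩ := exists_adj_of_induce_connected G hconn (fun x => f x ≠ 0)
    huΛ hvΛ hu (not_not.2 (hf0 v hvΓ))
  rw [not_not] at hfa
  rw [Finset.mem_coe] at ha
  have hS : 0 < ∑ y ∈ Λ, if G.Adj a y then f y else 0 := by
    refine Finset.sum_pos' (fun y _ => by split_ifs <;> simp [hf]) ⟨b, hb, ?_⟩
    rw [if_pos hab.symm]
    exact lt_of_le_of_ne (abs_nonneg _) (Ne.symm hfb)
  obtain ⟨t, ht⟩ := exists_pos_quadratic hS (degR G a * (q a - 1) - l * degR G a)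
  set ψ : V → ℝ := f + Pi.single a t with hψ
  have hψ0 : ∀ x ∉ Λ, ψ x = 0 := fun x hx => by
    have hxa : x ≠ a := fun h => hx (h ▸ ha)
    simp [hψ, hf0 x fun h => hx (hΓΛ.1 h), hxa]
  have hψ1 : ∑ x ∈ Λ, degR G x * ψ x ^ 2 = 1 + t ^ 2 * degR G a := by
    have hx : ∀ x, degR G x * ψ x ^ 2 =
        degR G x * f x ^ 2 + if x = a then t ^ 2 * degR G x else 0 := by
      intro x
      by_cases hx : x = a
      · subst hx; simp [hψ, hfa]; ring
      · simp [hψ, hx]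
    simp only [hx, Finset.sum_add_distrib, hf1, Finset.sum_ite_eq', ha, if_true]
  have hN : 0 < 1 + t ^ 2 * degR G a := by
    have := one_le_degR G (hlf a) (hdeg a)
    positivity
  have hform := dirichletForm_add_single G q ha hfa t
  have hlt : l * (1 + t ^ 2 * degR G a) < dirichletForm G Λ q ψ := by
    rw [hform]
    linarith
  set c := (√(1 + t ^ 2 * degR G a))⁻¹ with hc
  have hc2 : c ^ 2 = (1 + t ^ 2 * degR G a)⁻¹ := by
    rw [hc, inv_pow, Real.sq_sqrt hN.le]
  have hmem : c • ψ ∈ dirichletSphere G Λ := by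
    refine ⟨fun x hx => by simp [hψ0 x hx], ?_⟩
    have : ∀ x, degR G x * (c • ψ) x ^ 2 = c ^ 2 * (degR G x * ψ x ^ 2) := fun x => by
      simp only [Pi.smul_apply, smul_eq_mul]; ring
    simp only [this]
    rw [← Finset.mul_sum, hψ1, hc2, inv_mul_cancel₀ hN.ne']
  refine lt_of_lt_of_le ?_ (le_csSup ((isCompact_dirichletSphere G hlf hdeg Λ).image
    (continuous_dirichletForm G Λ q)).bddAbove ⟨_, hmem, rfl⟩)
  rw [dirichletForm_smul, hc2, inv_mul_eq_div, lt_div_iff₀ hN]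
  exact hlt
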